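/- arXiv:2112.07255 — 3 statements merged into one kernel-verified Lean document; each statement's English description precedes it below -/
import Mathlib

section
/- For additive valuations, the round-robin picking allocation is EF1: if n agents with additive valuations are processed in a fixed order repeated cyclically, and on its turn each agent is allocated a remaining good of maximum value according to its own valuation (ties broken by a fixed order on goods) until all goods are allocated, then the resulting complete allocation is EF1 with respect to those valuations. -/
/-- From a list of remaining goods (listed in the fixed tie-breaking order),
pick the first good with maximum value under `w` (`none` if the list is empty). -/
noncomputable def pickBest {G : Type*} (w : G → ℝ) : List G → Option G
  | [] => none
  | g :: rest =>
    match pickBest w rest with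
    | none => some g
    | some g' => if w g' > w g then some g' else some g

/-- Run a picking sequence: `turns` is the list of agents' turns, `R` the list
of remaining goods in the fixed tie-breaking order.  On its turn, an agent is
allocated the remaining good with the highest value under its own valuation,
ties broken in favour of goods earlier in the fixed order.  Returns the bundle
each agent ends up with. -/
noncomputable def pickingRun {I G : Type*} [DecidableEq I] [DecidableEq G]
    (v : I → G → ℝ) : List I → List G → I → Finset G
  | [], _ => fun _ => ∅
  | i :: ts, R =>
    match pickBest (v i) R with
    | none => fun _ => ∅
    | some g => fun j => (if j = i then {g} else ∅) ∪ pickingRun v ts (R.erase g) j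

/-- Round-robin picking for `n` agents and `m` goods: the agent order
`0, 1, …, n-1` is repeated cyclically until all `m` goods are allocated. -/
noncomputable def roundRobin {n m : ℕ} (hn : 0 < n)
    (v : Fin n → Fin m → ℝ) : Fin n → Finset (Fin m) :=
  pickingRun v ((List.range m).map fun t => (⟨t % n, Nat.mod_lt t hn⟩ : Fin n))
    (List.finRange m)

theorem pickBest_eq_none {G : Type*} {w : G → ℝ} {R : List G} (h : pickBest w R = none) :
    R = [] := by
  cases R with
  | nil => rfl
  | cons a R =>
    simp only [pickBest] at h
    split at h
    · simp at h
    · split_ifs at h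

theorem pickBest_eq_some {G : Type*} {w : G → ℝ} {R : List G} {g : G}
    (h : pickBest w R = some g) : g ∈ R ∧ ∀ x ∈ R, w x ≤ w g := by
  induction R generalizing g with
  | nil => simp [pickBest] at h
  | cons a R ih =>
    simp only [pickBest] at h
    split at h
    · next hn =>
      obtain rfl := pickBest_eq_none hn
      obtain rfl := Option.some.inj h
      simp
    · next g' hg' =>
      obtain ⟨hmem, hmax⟩ := ih hg'
      split_ifs at h with hlt
      · obtain rfl := Option.some.inj h
        refine ⟨List.mem_cons_of_mem _ hmem, fun x hx => ?_⟩
        rcases List.mem_cons.1 hx with rfl | hx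
        · exact hlt.le
        · exact hmax x hx
      · obtain rfl := Option.some.inj h
        refine ⟨List.mem_cons_self, fun x hx => ?_⟩
        rcases List.mem_cons.1 hx with rfl | hx
        · exact le_rfl
        · exact (hmax x hx).trans (not_lt.1 hlt)

section PickingRun

variable {I G : Type*} [DecidableEq I] [DecidableEq G] {v : I → G → ℝ}

theorem pickingRun_of_none {t : I} {ts : List I} {R : List G} (h : pickBest (v t) R = none)
    (x : I) : pickingRun v (t :: ts) R x = ∅ := by
  simp [pickingRun, h]

theorem pickingRun_self_of_some {t : I} {ts : List I} {R : List G} {g : G}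
    (h : pickBest (v t) R = some g) :
    pickingRun v (t :: ts) R t = insert g (pickingRun v ts (R.erase g) t) := by
  simp [pickingRun, h]

theorem pickingRun_of_ne_of_some {t x : I} {ts : List I} {R : List G} {g : G}
    (h : pickBest (v t) R = some g) (hx : x ≠ t) :
    pickingRun v (t :: ts) R x = pickingRun v ts (R.erase g) x := by
  simp [pickingRun, h, hx]

theorem mem_of_mem_pickingRun {ts : List I} {R : List G} {x : I} {g : G}
    (h : g ∈ pickingRun v ts R x) : g ∈ R := by
  induction ts generalizing R with
  | nil => simp [pickingRun] at h
  | cons t ts ih =>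
    cases hp : pickBest (v t) R with
    | none => simp [pickingRun_of_none hp] at h
    | some a =>
      by_cases hx : x = t
      · subst hx
        rw [pickingRun_self_of_some hp, Finset.mem_insert] at h
        rcases h with rfl | h
        · exact (pickBest_eq_some hp).1
        · exact List.mem_of_mem_erase (ih h)
      · rw [pickingRun_of_ne_of_some hp hx] at h
        exact List.mem_of_mem_erase (ih h)

theorem notMem_pickingRun_erase {ts : List I} {R : List G} (hR : R.Nodup) (x : I) (g : G) :
    g ∉ pickingRun v ts (R.erase g) x :=
  fun h => hR.not_mem_erase (mem_of_mem_pickingRun h)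

/-- If agent `j` never gets more than `k` turns ahead of agent `i`, then `i` values the bundle of
`j` at most at `k` times an upper bound on the remaining goods more than its own bundle. -/
theorem sum_pickingRun_le {i j : I} (hij : i ≠ j) {ts : List I} {R : List G} (hR : R.Nodup)
    {k : ℕ} (hk : ∀ l, l <+: ts → l.count j ≤ l.count i + k)
    {M : ℝ} (hM : 0 ≤ M) (hv : ∀ g ∈ R, 0 ≤ v i g) (hRM : ∀ g ∈ R, v i g ≤ M) :
    ∑ g ∈ pickingRun v ts R j, v i g ≤ ∑ g ∈ pickingRun v ts R i, v i g + k * M := by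
  induction ts generalizing R k M with
  | nil => simpa [pickingRun] using by positivity
  | cons t ts ih =>
    cases hp : pickBest (v t) R with
    | none => simpa [pickingRun_of_none hp] using by positivity
    | some g =>
      obtain ⟨hgR, hmax⟩ := pickBest_eq_some hp
      have hk' : ∀ l, l <+: ts → (t :: l).count j ≤ (t :: l).count i + k :=
        fun l hl => hk _ (List.cons_prefix_cons.2 ⟨rfl, hl⟩)
      have hsub : ∀ a ∈ R.erase g, a ∈ R := fun a => List.mem_of_mem_erase
      have hg := notMem_pickingRun_erase (v := v) (ts := ts) hR t g
      by_cases hti : t = i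
      · subst hti
        rw [pickingRun_self_of_some hp, pickingRun_of_ne_of_some hp hij.symm,
          Finset.sum_insert hg]
        have := ih (hR.erase g) (k := k + 1)
          (fun l hl => by have := hk' l hl; simp [hij] at this; omega)
          (hv g hgR) (fun a ha => hv a (hsub a ha)) (fun a ha => hmax a (hsub a ha))
        have hkM : (k : ℝ) * v t g ≤ k * M := by gcongr; exact hRM g hgR
        push_cast at this
        linarith
      by_cases htj : t = j
      · subst htj
        rw [pickingRun_self_of_some hp, pickingRun_of_ne_of_some hp hij, Finset.sum_insert hg]
        obtain ⟨k, rfl⟩ : ∃ k', k = k' + 1 := Nat.exists_eq_add_one.2 <| by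
          have := hk' [] (by simp)
          simp [hij.symm] at this
          omega
        have := ih (hR.erase g) (k := k)
          (fun l hl => by have := hk' l hl; simp [hij.symm] at this; omega)
          hM (fun a ha => hv a (hsub a ha)) (fun a ha => hRM a (hsub a ha))
        have hgM := hRM g hgR
        push_cast
        linarith
      · rw [pickingRun_of_ne_of_some hp (Ne.symm hti), pickingRun_of_ne_of_some hp (Ne.symm htj)]
        exact ih (hR.erase g)
          (fun l hl => by simpa [List.count_cons, hti, htj] using hk' l hl)
          hM (fun a ha => hv a (hsub a ha)) (fun a ha => hRM a (hsub a ha))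

/-- If agent `j` never gets more than `k + 1` turns ahead of agent `i`, then the bound of
`sum_pickingRun_le` holds after removing one good from the bundle of `j`. -/
theorem exists_sum_pickingRun_erase_le {i j : I} (hij : i ≠ j) {ts : List I} {R : List G}
    (hR : R.Nodup) {k : ℕ} (hk : ∀ l, l <+: ts → l.count j ≤ l.count i + (k + 1))
    {M : ℝ} (hM : 0 ≤ M) (hv : ∀ g ∈ R, 0 ≤ v i g) (hRM : ∀ g ∈ R, v i g ≤ M) :
    pickingRun v ts R j = ∅ ∨ ∃ a ∈ pickingRun v ts R j,
      ∑ g ∈ (pickingRun v ts R j).erase a, v i g ≤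
        ∑ g ∈ pickingRun v ts R i, v i g + k * M := by
  induction ts generalizing R k M with
  | nil => exact Or.inl rfl
  | cons t ts ih =>
    cases hp : pickBest (v t) R with
    | none => exact Or.inl (pickingRun_of_none hp j)
    | some g =>
      obtain ⟨hgR, hmax⟩ := pickBest_eq_some hp
      have hk' : ∀ l, l <+: ts → (t :: l).count j ≤ (t :: l).count i + (k + 1) :=
        fun l hl => hk _ (List.cons_prefix_cons.2 ⟨rfl, hl⟩)
      have hsub : ∀ a ∈ R.erase g, a ∈ R := fun a => List.mem_of_mem_erase
      have hg := notMem_pickingRun_erase (v := v) (ts := ts) hR t g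
      by_cases hti : t = i
      · subst hti
        rw [pickingRun_self_of_some hp, pickingRun_of_ne_of_some hp hij.symm,
          Finset.sum_insert hg]
        refine (ih (hR.erase g) (k := k + 1)
          (fun l hl => by have := hk' l hl; simp [hij] at this; omega)
          (hv g hgR) (fun a ha => hv a (hsub a ha))
          (fun a ha => hmax a (hsub a ha))).imp_right ?_
        rintro ⟨a, ha, hle⟩
        refine ⟨a, ha, ?_⟩
        have hkM : (k : ℝ) * v t g ≤ k * M := by gcongr; exact hRM g hgR
        push_cast at hle
        linarith
      by_cases htj : t = j
      · subst htj
        rw [pickingRun_self_of_some hp, pickingRun_of_ne_of_some hp hij]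
        refine Or.inr ⟨g, Finset.mem_insert_self _ _, ?_⟩
        rw [Finset.erase_insert hg]
        exact sum_pickingRun_le hij (hR.erase g)
          (fun l hl => by have := hk' l hl; simp [hij.symm] at this; omega)
          hM (fun a ha => hv a (hsub a ha)) (fun a ha => hRM a (hsub a ha))
      · rw [pickingRun_of_ne_of_some hp (Ne.symm hti), pickingRun_of_ne_of_some hp (Ne.symm htj)]
        exact ih (hR.erase g)
          (fun l hl => by simpa [List.count_cons, hti, htj] using hk' l hl)
          hM (fun a ha => hv a (hsub a ha)) (fun a ha => hRM a (hsub a ha))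

end PickingRun

theorem count_map_range_mod {n : ℕ} (hn : 0 < n) (p : ℕ) (x : Fin n) :
    ((List.range p).map fun t => (⟨t % n, Nat.mod_lt t hn⟩ : Fin n)).count x =
      p / n + if (x : ℕ) < p % n then 1 else 0 := by
  have h := Nat.count_modEq_card p hn x
  rw [Nat.mod_eq_of_lt x.2] at h
  rw [← h, List.count, List.countP_map, Nat.count]
  refine List.countP_congr fun t _ => ?_
  simp [Fin.ext_iff, Nat.ModEq, Nat.mod_eq_of_lt x.2]

theorem count_prefix_roundRobin_turns {n : ℕ} (hn : 0 < n) (m : ℕ) (i j : Fin n)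
    (l : List (Fin n))
    (hl : l <+: (List.range m).map fun t => (⟨t % n, Nat.mod_lt t hn⟩ : Fin n)) :
    l.count j ≤ l.count i + 1 := by
  rw [List.prefix_iff_eq_take.1 hl, ← List.map_take, List.take_range, count_map_range_mod hn,
    count_map_range_mod hn]
  split_ifs <;> omega

/-- For (nonnegative) additive valuations, the round-robin picking allocation
is EF1: for all agents `i, j`, either `j`'s bundle is empty or it contains a
good `a` with `v_i(A_i) ≥ v_i(A_j \ {a})`. -/
theorem round_robin_is_EF1 {n m : ℕ} (hn : 0 < n)
    (v : Fin n → Fin m → ℝ) (hv : ∀ i g, 0 ≤ v i g) :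
    ∀ i j : Fin n,
      roundRobin hn v j = ∅ ∨
        ∃ a ∈ roundRobin hn v j,
          (∑ g ∈ roundRobin hn v i, v i g) ≥
            ∑ g ∈ (roundRobin hn v j).erase a, v i g := by
  intro i j
  by_cases hij : i = j
  · subst hij
    refine (roundRobin hn v i).eq_empty_or_nonempty.imp_right ?_
    rintro ⟨a, ha⟩
    exact ⟨a, ha, Finset.sum_le_sum_of_subset_of_nonneg (Finset.erase_subset _ _)
      fun g _ _ => hv i g⟩
  · simpa [roundRobin] using exists_sum_pickingRun_erase_le (v := v) hij
      (List.nodup_finRange m) (k := 0)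
      (count_prefix_roundRobin_turns hn m i j) (Finset.sum_nonneg fun g _ => hv i g)
      (fun g _ => hv i g)
      (fun g _ => Finset.single_le_sum (fun a _ => hv i a) (Finset.mem_univ g))
end

section
/- When all agents are single-minded and report truthfully, the allocation produced by the serial dictatorship mechanism is EFX: for all agents i, j and every good a in the bundle A_j produced by the mechanism, v_i(A_i) >= v_i(A_j \ {a}). -/
/-- Single-minded valuation with desired bundle `D` and value `c`:
a set is worth `c` if it contains `D`, and `0` otherwise. -/
def smVal {G : Type*} [DecidableEq G] (D : Finset G) (c : ℝ) (S : Finset G) : ℝ :=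
  if D ⊆ S then c else 0

/-- Process the agents in the given order, maintaining the set `R` of remaining
goods: at agent `i`'s turn, if its desired bundle `D i` is still entirely
available then `i` receives `D i` (which is removed from `R`), and otherwise
`i` receives nothing; the last agent in the processing order additionally
receives all leftover goods. -/
def sdProcess {n : ℕ} {G : Type*} [DecidableEq G]
    (D : Fin n → Finset G) : List (Fin n) → Finset G → Fin n → Finset G
  | [], _ => fun _ => ∅
  | [i], R => fun j => if j = i then R else ∅
  | i :: k :: ks, R =>
    if D i ⊆ R then
      fun j => (if j = i then D i else ∅) ∪ sdProcess D (k :: ks) (R \ D i) j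
    else sdProcess D (k :: ks) R

/-- The processing order of the serial dictatorship mechanism: agents sorted by
nondecreasing desired bundle size, ties broken by agent index. -/
def sdOrder {n : ℕ} {G : Type*} (D : Fin n → Finset G) : List (Fin n) :=
  (List.finRange n).mergeSort fun a b =>
    decide ((D a).card < (D b).card ∨ ((D a).card = (D b).card ∧ a ≤ b))

/-- The serial dictatorship mechanism for single-minded agents on desired
bundles `D`. -/
def sdMech {n : ℕ} {G : Type*} [Fintype G] [DecidableEq G]
    (D : Fin n → Finset G) : Fin n → Finset G :=
  sdProcess D (sdOrder D) Finset.univ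

theorem sdProcess_subset {n : ℕ} {G : Type*} [DecidableEq G] (D : Fin n → Finset G)
    (L : List (Fin n)) (R : Finset G) (j : Fin n) : sdProcess D L R j ⊆ R := by
  fun_induction sdProcess D L R with
  | case1 R => simp
  | case2 i R => dsimp only; split_ifs <;> simp
  | case3 i k ks R h ih =>
    refine Finset.union_subset ?_ (ih.trans Finset.sdiff_subset)
    split_ifs
    · exact h
    · simp
  | case4 i k ks R h ih => exact ih

theorem sdProcess_eq_empty_of_notMem {n : ℕ} {G : Type*} [DecidableEq G] (D : Fin n → Finset G)
    (L : List (Fin n)) (R : Finset G) {j : Fin n} (hj : j ∉ L) : sdProcess D L R j = ∅ := by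
  fun_induction sdProcess D L R with
  | case1 R => rfl
  | case2 i R => simp_all
  | case3 i k ks R h ih => simp_all
  | case4 i k ks R h ih => simp_all

/-- If the agents are processed by nondecreasing bundle size, an agent whose desired bundle lies
strictly inside some allocated bundle is itself satisfied. -/
theorem subset_sdProcess_of_ssubset {n : ℕ} {G : Type*} [DecidableEq G] (D : Fin n → Finset G)
    (L : List (Fin n)) (R : Finset G) (hnd : L.Nodup)
    (hs : L.Pairwise fun a b => (D a).card ≤ (D b).card) {i j : Fin n} (hi : i ∈ L)
    (h : D i ⊂ sdProcess D L R j) : D i ⊆ sdProcess D L R i := by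
  fun_induction sdProcess D L R with
  | case1 R => simp at hi
  | case2 k R =>
    obtain rfl := List.mem_singleton.mp hi
    dsimp only at h
    split_ifs at h
    · simpa using h.subset
    · simp at h
  | case3 k k' ks R hk ih =>
    rcases List.mem_cons.mp hi with rfl | hmem
    · simp
    have hik : i ≠ k := fun e => (List.nodup_cons.mp hnd).1 (e ▸ hmem)
    by_cases hj : j = k
    · subst hj
      dsimp only at h
      rw [sdProcess_eq_empty_of_notMem D _ _ (List.nodup_cons.mp hnd).1] at h
      have hlt := Finset.card_lt_card h
      have hle := (List.pairwise_cons.mp hs).1 i hmem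
      simp only [if_true, Finset.union_empty] at hlt
      omega
    · simp only [hj, hik, if_false, Finset.empty_union] at h ⊢
      exact ih hnd.of_cons hs.of_cons hmem h
  | case4 k k' ks R hk ih =>
    rcases List.mem_cons.mp hi with rfl | hi
    · exact absurd (h.subset.trans (sdProcess_subset D _ R j)) hk
    · exact ih hnd.of_cons hs.of_cons hi h

theorem sdOrder_perm {n : ℕ} {G : Type*} (D : Fin n → Finset G) :
    (sdOrder D).Perm (List.finRange n) :=
  List.mergeSort_perm _ _

theorem sdOrder_pairwise_card_le {n : ℕ} {G : Type*} (D : Fin n → Finset G) :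
    (sdOrder D).Pairwise fun a b => (D a).card ≤ (D b).card := by
  refine (List.pairwise_mergeSort ?_ ?_ (List.finRange n)).imp ?_
  · intro a b c hab hbc
    simp only [decide_eq_true_eq] at *
    omega
  · intro a b
    simp only [Bool.or_eq_true, decide_eq_true_eq]
    omega
  · intro a b hab
    simp only [decide_eq_true_eq] at hab
    omega

/-- When all agents are single-minded (agent `i` desiring the nonempty bundle
`D i` at value `c i > 0`) and report truthfully, the allocation produced by the
serial dictatorship mechanism is EFX: for all agents `i, j` and every good `a`
in `j`'s bundle `A_j`, `v_i(A_i) ≥ v_i(A_j \ {a})`. -/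
theorem serial_dictatorship_single_minded_EFX
    {n : ℕ} {G : Type*} [Fintype G] [DecidableEq G]
    (D : Fin n → Finset G) (hD : ∀ i, (D i).Nonempty)
    (c : Fin n → ℝ) (hc : ∀ i, 0 < c i) :
    ∀ i j : Fin n, ∀ a ∈ sdMech D j,
      smVal (D i) (c i) (sdMech D i) ≥
        smVal (D i) (c i) ((sdMech D j).erase a) := by
  intro i j a ha
  have key : D i ⊆ (sdMech D j).erase a → D i ⊆ sdMech D i := fun h =>
    subset_sdProcess_of_ssubset D (sdOrder D) Finset.univ
      ((sdOrder_perm D).nodup_iff.mpr (List.nodup_finRange n)) (sdOrder_pairwise_card_le D)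
      ((sdOrder_perm D).mem_iff.mpr (List.mem_finRange i))
      (h.trans_ssubset (Finset.erase_ssubset ha))
  unfold smVal
  split_ifs with h₁ h₂ h₂
  · exact le_rfl
  · exact (hc i).le
  · exact absurd (key h₂) h₁
  · exact le_rfl
end

section
/- There is no deterministic strategy-proof mechanism for 2 agents and 3 indivisible goods with additive valuations that outputs an envy-free complete allocation whenever the reported profile admits one. That is, if a mechanism f maps every pair of additive valuations over 3 goods to a complete allocation, and f(v) is envy-free with respect to v for every profile v that admits an envy-free allocation, then there exist a profile, an agent i, and a misreport by agent i under which agent i's true value of its bundle strictly increases. -/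
/-- The bundle of goods assigned to agent `i` by the complete allocation `A`. -/
def bundle {n m : ℕ} (A : Fin m → Fin n) (i : Fin n) : Finset (Fin m) :=
  Finset.univ.filter fun g => A g = i

/-- Additive value of a set of goods given per-good values. -/
def val {m : ℕ} (v : Fin m → ℝ) (S : Finset (Fin m)) : ℝ := ∑ g ∈ S, v g

/-- An allocation is envy-free: `v_i(A_i) ≥ v_i(A_j)` for all agents `i, j`. -/
def IsEnvyFree {n m : ℕ} (v : Fin n → Fin m → ℝ) (A : Fin m → Fin n) : Prop :=
  ∀ i j : Fin n, val (v i) (bundle A i) ≥ val (v i) (bundle A j)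

theorem eq_zero_or_eq_one_of_fin_two : ∀ a : Fin 2, a = 0 ∨ a = 1 := by
  decide

theorem val_bundle_three {n : ℕ} (a b c : ℝ) (A : Fin 3 → Fin n) (i : Fin n) :
    val ![a, b, c] (bundle A i) = (if A 0 = i then a else 0) + (if A 1 = i then b else 0) +
      (if A 2 = i then c else 0) := by
  simp [val, bundle, Finset.sum_filter, Fin.sum_univ_three]

theorem isEnvyFree_two_three_iff (v : Fin 2 → Fin 3 → ℝ) (A : Fin 3 → Fin 2) :
    IsEnvyFree v A ↔ val (v 0) (bundle A 1) ≤ val (v 0) (bundle A 0) ∧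
      val (v 1) (bundle A 0) ≤ val (v 1) (bundle A 1) := by
  simp [IsEnvyFree, Fin.forall_fin_two]

/-- There is no deterministic strategy-proof mechanism for 2 agents and 3 goods
with additive (nonnegative) valuations that outputs an envy-free complete
allocation whenever the reported profile admits one: any mechanism whose output
is envy-free w.r.t. every reported profile admitting an envy-free allocation
has a profile, an agent `i`, and a misreport under which agent `i`'s true value
of its bundle strictly increases. -/
theorem no_strategyproof_envy_free_mechanism_two_agents_three_goods
    (f : (Fin 2 → Fin 3 → ℝ) → (Fin 3 → Fin 2))
    (hEF : ∀ v : Fin 2 → Fin 3 → ℝ, (∀ i g, 0 ≤ v i g) →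
      (∃ A : Fin 3 → Fin 2, IsEnvyFree v A) → IsEnvyFree v (f v)) :
    ∃ v : Fin 2 → Fin 3 → ℝ, (∀ i g, 0 ≤ v i g) ∧
      ∃ (i : Fin 2) (v' : Fin 3 → ℝ), (∀ g, 0 ≤ v' g) ∧
        val (v i) (bundle (f (Function.update v i v')) i) >
          val (v i) (bundle (f v) i) := by
  obtain ⟨u, hu⟩ : ∃ u : Fin 2 → Fin 3 → ℝ, u = ![![1, 2, 0], ![1, 2, 3]] := ⟨_, rfl⟩
  have hu0 : ∀ i g, 0 ≤ u i g := by
    simp [hu, Fin.forall_fin_succ]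
  have hv0 : u 0 = ![1, 2, 0] := by simp [hu]
  have hv1 : u 1 = ![1, 2, 3] := by simp [hu]
  have hleft : Function.update u 0 ![2, 2, 1] = ![![2, 2, 1], ![1, 2, 3]] := by
    ext i g; fin_cases i <;> simp [hu]
  have hright : Function.update u 1 ![1, 3, 3] = ![![1, 2, 0], ![1, 3, 3]] := by
    ext i g; fin_cases i <;> simp [hu]
  -- In `u`, the first agent receives either `{1}` or `{0, 1}`.
  have hbase : f u 1 = 0 ∧ f u 2 = 1 := by
    have h := hEF u hu0 ⟨![0, 0, 1], by
      simp [isEnvyFree_two_three_iff, val_bundle_three, hv0, hv1]; norm_num⟩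
    generalize f u = A at h ⊢
    rw [isEnvyFree_two_three_iff] at h
    revert h
    rcases eq_zero_or_eq_one_of_fin_two (A 0) with h0 | h0 <;>
    rcases eq_zero_or_eq_one_of_fin_two (A 1) with h1 | h1 <;>
    rcases eq_zero_or_eq_one_of_fin_two (A 2) with h2 | h2 <;>
    norm_num [val_bundle_three, hv0, hv1, h0, h1, h2]
  by_cases hgood : f u 0 = 0
  · -- The second agent holds only good `2` and gains by misreporting.
    refine ⟨u, hu0, 1, ![1, 3, 3], by simp [Fin.forall_fin_succ], ?_⟩
    have h := hEF (Function.update u 1 ![1, 3, 3])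
      (by simp [hright, Fin.forall_fin_succ]) ⟨![1, 0, 1], by
        simp [isEnvyFree_two_three_iff, val_bundle_three, hright]⟩
    generalize f (Function.update u 1 ![1, 3, 3]) = A at h ⊢
    rw [isEnvyFree_two_three_iff, hright] at h
    revert h
    rcases eq_zero_or_eq_one_of_fin_two (A 0) with h0 | h0 <;>
    rcases eq_zero_or_eq_one_of_fin_two (A 1) with h1 | h1 <;>
    rcases eq_zero_or_eq_one_of_fin_two (A 2) with h2 | h2 <;>
    norm_num [val_bundle_three, hv0, hv1, hbase, hgood, h0, h1, h2]
  · -- The first agent holds only good `1` and gains by misreporting.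
    refine ⟨u, hu0, 0, ![2, 2, 1], by simp [Fin.forall_fin_succ], ?_⟩
    have h := hEF (Function.update u 0 ![2, 2, 1])
      (by simp [hleft, Fin.forall_fin_succ]) ⟨![0, 0, 1], by
        simp [isEnvyFree_two_three_iff, val_bundle_three, hleft]; norm_num⟩
    generalize f (Function.update u 0 ![2, 2, 1]) = A at h ⊢
    rw [isEnvyFree_two_three_iff, hleft] at h
    revert h
    rcases eq_zero_or_eq_one_of_fin_two (A 0) with h0 | h0 <;>
    rcases eq_zero_or_eq_one_of_fin_two (A 1) with h1 | h1 <;>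
    rcases eq_zero_or_eq_one_of_fin_two (A 2) with h2 | h2 <;>
    norm_num [val_bundle_three, hv0, hv1, hbase, hgood, h0, h1, h2]
end
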